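/- Let A be a symmetric endomorphism of a 2m-dimensional real inner product space, let α ≠ K be real numbers and r₀ a real number with 0 ≤ r₀ ≤ 2m. If tr(Aˢ) = (2m - r₀) Kˢ + r₀ αˢ for every natural number s ≥ 1, then r₀ is a natural number, and A has exactly the eigenvalues α with multiplicity r₀ and K with multiplicity 2m - r₀ (interpreting multiplicity 0 as the eigenvalue not occurring). -/

import Mathlib

open Polynomial in
theorem LinearMap.IsSymmetric.trace_aeval_eq_sum_eval_eigenvalues
    {V : Type*} [NormedAddCommGroup V] [InnerProductSpace ℝ V] [FiniteDimensional ℝ V]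
    {n : ℕ} (hn : Module.finrank ℝ V = n) {A : Module.End ℝ V} (hA : A.IsSymmetric) (p : ℝ[X]) :
    LinearMap.trace ℝ V (aeval A p) = ∑ i, p.eval (hA.eigenvalues hn i) := by
  rw [LinearMap.trace_eq_sum_inner _ (hA.eigenvectorBasis hn)]
  refine Finset.sum_congr rfl fun i _ => ?_
  rw [Module.End.aeval_apply_of_hasEigenvector (hA.hasEigenvector_eigenvectorBasis hn i),
    real_inner_smul_right, real_inner_self_eq_norm_sq, OrthonormalBasis.norm_eq_one]
  simp

open Polynomial in
theorem Polynomial.trace_aeval_eq_of_trace_pow_eq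
    {V : Type*} [AddCommGroup V] [Module ℝ V] {A : Module.End ℝ V} {a b α K : ℝ}
    (h : ∀ s : ℕ, LinearMap.trace ℝ V (A ^ s) = a * K ^ s + b * α ^ s) (p : ℝ[X]) :
    LinearMap.trace ℝ V (aeval A p) = a * p.eval K + b * p.eval α := by
  induction p using Polynomial.induction_on' with
  | add p q hp hq => simp only [map_add, hp, hq, eval_add]; ring
  | monomial s c =>
    rw [aeval_monomial, ← Algebra.smul_def, map_smul, h, eval_monomial, eval_monomial, smul_eq_mul]
    ring

theorem two_eigenvalues_from_power_traces
    {V : Type*} [NormedAddCommGroup V] [InnerProductSpace ℝ V] [FiniteDimensional ℝ V]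
    (m : ℕ) (hm : 1 ≤ m) (hdim : Module.finrank ℝ V = 2 * m)
    (A : Module.End ℝ V) (hA : A.IsSymmetric)
    (α K r₀ : ℝ) (hαK : α ≠ K) (hr₀ : 0 ≤ r₀ ∧ r₀ ≤ 2 * m)
    (htr : ∀ s : ℕ, 1 ≤ s →
      LinearMap.trace ℝ V (A ^ s) = (2 * m - r₀) * K ^ s + r₀ * α ^ s) :
    ∃ n : ℕ, n ≤ 2 * m ∧ r₀ = (n : ℝ) ∧
      Module.finrank ℝ (Module.End.eigenspace A α) = n ∧
      Module.finrank ℝ (Module.End.eigenspace A K) = 2 * m - n ∧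
      ∀ μ : ℝ, Module.End.HasEigenvalue A μ → μ = α ∨ μ = K := by
  have hpow : ∀ s : ℕ,
      LinearMap.trace ℝ V (A ^ s) = (2 * m - r₀) * K ^ s + r₀ * α ^ s := by
    intro s
    rcases Nat.eq_zero_or_pos s with rfl | hs
    · rw [pow_zero, LinearMap.trace_one, hdim]
      push_cast
      ring
    · exact htr s hs
  have hsum : ∀ p : Polynomial ℝ, ∑ i, p.eval (hA.eigenvalues hdim i) =
      (2 * m - r₀) * p.eval K + r₀ * p.eval α := fun p => by
    rw [← hA.trace_aeval_eq_sum_eval_eigenvalues, Polynomial.trace_aeval_eq_of_trace_pow_eq hpow]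
  have hmem : ∀ i, hA.eigenvalues hdim i = α ∨ hA.eigenvalues hdim i = K := by
    intro i
    have h := hsum (((Polynomial.X - Polynomial.C α) * (Polynomial.X - Polynomial.C K)) ^ 2)
    simp only [Polynomial.eval_pow, Polynomial.eval_mul, Polynomial.eval_sub, Polynomial.eval_X,
      Polynomial.eval_C, sub_self, mul_zero, zero_mul, add_zero, ne_eq, OfNat.ofNat_ne_zero,
      not_false_eq_true, zero_pow] at h
    have hi := (Finset.sum_eq_zero_iff_of_nonneg fun _ _ => sq_nonneg _).1 h i (Finset.mem_univ i)
    simpa [sub_eq_zero] using hi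
  have hcard := Finset.card_filter_add_card_filter_not (s := Finset.univ)
    (fun i => hA.eigenvalues hdim i = α)
  have hnot : Finset.univ.filter (fun i => ¬ hA.eigenvalues hdim i = α) =
      Finset.univ.filter (fun i => hA.eigenvalues hdim i = K) := by
    refine Finset.filter_congr fun i _ => ⟨(hmem i).resolve_left, fun h h' => ?_⟩
    exact hαK (h'.symm.trans h)
  have hmult : ∀ μ : ℝ, (Finset.univ.filter fun i => hA.eigenvalues hdim i = μ).card =
      Module.finrank ℝ (Module.End.eigenspace A μ) := fun μ => by
    simpa using hA.card_filter_eigenvalues_eq hdim μ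
  rw [hnot, hmult, hmult, Finset.card_univ,
    Fintype.card_fin] at hcard
  refine ⟨Module.finrank ℝ (Module.End.eigenspace A α), by omega, ?_, rfl, by omega, ?_⟩
  · have h := hsum (Polynomial.X - Polynomial.C K)
    simp only [Polynomial.eval_sub, Polynomial.eval_X, Polynomial.eval_C, sub_self, mul_zero,
      zero_add] at h
    have hterm : ∀ i, hA.eigenvalues hdim i - K =
        if hA.eigenvalues hdim i = α then α - K else 0 := by
      intro i
      split_ifs with hi
      · rw [hi]
      · rw [(hmem i).resolve_left hi, sub_self]
    rw [Finset.sum_congr rfl fun i _ => hterm i, ← Finset.sum_filter, Finset.sum_const,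
      hmult, nsmul_eq_mul] at h
    exact (mul_right_cancel₀ (sub_ne_zero.2 hαK) h).symm
  · intro μ hμ
    obtain ⟨i, hi⟩ := hA.exists_eigenvalues_eq hdim hμ
    have hi' : hA.eigenvalues hdim i = μ := by simpa using hi
    exact hi' ▸ hmem i
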